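/- For every l ≥ 1, the operator L^{(l)}_{n,m} = e*·L^{2l}·e commutes with the deformed rational B-type CMS operator: [L^{(l)}_{n,m}, H_{n,m}] = 0 in End_ℂ(F); moreover these operators commute with each other: [L^{(l)}_{n,m}, L^{(l')}_{n,m}] = 0 for all l, l' ≥ 1. -/

import Mathlib

open Polynomial MvPolynomial

noncomputable section

variable (n m : ℕ)

/-- the polynomial ring ℂ[x₁,…,x_{n+m}] -/
abbrev PR (n m : ℕ) : Type := MvPolynomial (Fin (n + m)) ℂ
/-- F = ℂ(x₁,…,x_{n+m}), the field of rational functions -/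
abbrev F (n m : ℕ) : Type := FractionRing (PR n m)

/-- the embedding ℂ[x₁,…,x_{n+m}] → ℂ(x₁,…,x_{n+m}) -/
def emb (f : PR n m) : F n m := algebraMap _ _ f

/-- image of x_i in F -/
def xi (i : Fin (n + m)) : F n m := emb n m (MvPolynomial.X i)

/-- image of a constant c ∈ ℂ in F -/
def cc (c : ℂ) : F n m := emb n m (MvPolynomial.C c)

/-- the parity p(i): 0 for the first n indices, 1 for the last m (valued in ℤ,
so that k^{p(i)}, k^{1−p(j)}, k^{−p(i)} make sense as zpow in the field F). -/
def pE (i : Fin (n + m)) : ℤ := if (i : ℕ) < n then 0 else 1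

/-- numerator of a chosen fraction representation of z ∈ F -/
def num (z : F n m) : PR n m :=
  (IsLocalization.sec (nonZeroDivisors (PR n m)) z).1

/-- denominator of a chosen fraction representation of z ∈ F -/
def den (z : F n m) : PR n m :=
  ((IsLocalization.sec (nonZeroDivisors (PR n m)) z).2 : PR n m)

/-- the partial derivative ∂/∂x_i on the field of rational functions F,
extending `MvPolynomial.pderiv i` by the quotient rule.  (Since z = num z / den z
for any z, this is exactly the unique extension of ∂/∂x_i to F.) -/
def fder (i : Fin (n + m)) (z : F n m) : F n m :=
  (emb n m (pderiv i (num n m z)) * emb n m (den n m z)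
    - emb n m (num n m z) * emb n m (pderiv i (den n m z)))
  / (emb n m (den n m z)) ^ 2

end

noncomputable section
variable (n m : ℕ) (k q s : ℂ)

/-- the multiplicity m(i): q for the first n indices, s for the last m (as an element
of F). -/
def mult (i : Fin (n + m)) : F n m := if (i : ℕ) < n then cc n m q else cc n m s

/-- the matrix A: A_{ii} = k^{p(i)} ∂/∂x_i, A_{ij} = mult. by k^{1−p(j)}/(x_i−x_j). -/
def Amat (i j : Fin (n + m)) : F n m → F n m :=
  if i = j then fun z => (cc n m k) ^ (pE n m i) * fder n m i z
  else fun z => (cc n m k) ^ (1 - pE n m j) * (xi n m i - xi n m j)⁻¹ * z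

/-- the matrix B: B_{ii} = mult. by k^{p(i)} m(i)/x_i, B_{ij} = mult. by
k^{1−p(j)}/(x_i+x_j). -/
def Bmat (i j : Fin (n + m)) : F n m → F n m :=
  if i = j then fun z => (cc n m k) ^ (pE n m i) * mult n m q s i * (xi n m i)⁻¹ * z
  else fun z => (cc n m k) ^ (1 - pE n m j) * (xi n m i + xi n m j)⁻¹ * z

/-- the B-type quantum Moser matrix, the 2(n+m)×2(n+m) block matrix
L = [[A, B], [−B, −A]] (indexed by Fin (n+m) ⊕ Fin (n+m)). -/
def LB : (Fin (n + m) ⊕ Fin (n + m)) → (Fin (n + m) ⊕ Fin (n + m)) → (F n m → F n m)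
  | Sum.inl i, Sum.inl j => Amat n m k i j
  | Sum.inl i, Sum.inr j => Bmat n m k q s i j
  | Sum.inr i, Sum.inl j => fun z => -(Bmat n m k q s i j z)
  | Sum.inr i, Sum.inr j => fun z => -(Amat n m k i j z)

/-- the row vector e*: e*_i = e*_{n+m+i} = k^{−p(i)}. -/
def estarB : (Fin (n + m) ⊕ Fin (n + m)) → F n m
  | Sum.inl i => (cc n m k) ^ (-(pE n m i))
  | Sum.inr i => (cc n m k) ^ (-(pE n m i))

/-- product of matrices of operators: (A·B)_{ij} = Σ_a A_{ia} ∘ B_{aj}. -/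
def mmul {ι α : Type*} [Fintype ι] [AddCommMonoid α]
    (A B : ι → ι → (α → α)) : ι → ι → (α → α) :=
  fun i j z => ∑ a, A i a (B a j z)

/-- power of a matrix of operators (the 0-th power is the identity matrix). -/
def mpow {ι α : Type*} [Fintype ι] [DecidableEq ι] [AddCommMonoid α]
    (A : ι → ι → (α → α)) : ℕ → ι → ι → (α → α)
  | 0 => fun i j z => if i = j then z else 0
  | r + 1 => mmul A (mpow A r)

/-- L^{(l)}_{n,m} = e*·L^{2l}·e, the deformed total trace of the 2l-th power of the
B-type quantum Moser matrix. -/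
def LopB (l : ℕ) (z : F n m) : F n m :=
  ∑ a : Fin (n + m) ⊕ Fin (n + m), ∑ b : Fin (n + m) ⊕ Fin (n + m),
    estarB n m k a * mpow (LB n m k q s) (2 * l) a b z

set_option maxHeartbeats 1000000 in
/-- the deformed rational B-type CMS operator H_{n,m} (potential terms acting by
multiplication). -/
def HB (z : F n m) : F n m :=
  -(∑ i ∈ Finset.univ.filter (fun i : Fin (n + m) => (i : ℕ) < n),
      fder n m i (fder n m i z))
  - cc n m k * (∑ j ∈ Finset.univ.filter (fun j : Fin (n + m) => n ≤ (j : ℕ)),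
      fder n m j (fder n m j z))
  + (∑ i : Fin (n + m), ∑ j : Fin (n + m),
      if (i : ℕ) < (j : ℕ) ∧ (j : ℕ) < n then
        2 * cc n m k * (cc n m k + 1) * (((xi n m i - xi n m j) ^ 2)⁻¹
          + ((xi n m i + xi n m j) ^ 2)⁻¹) else 0) * z
  + (∑ i : Fin (n + m), ∑ j : Fin (n + m),
      if n ≤ (i : ℕ) ∧ (i : ℕ) < (j : ℕ) then
        2 * ((cc n m k)⁻¹ + 1) * (((xi n m i - xi n m j) ^ 2)⁻¹
          + ((xi n m i + xi n m j) ^ 2)⁻¹) else 0) * z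
  + (∑ i : Fin (n + m), ∑ j : Fin (n + m),
      if (i : ℕ) < n ∧ n ≤ (j : ℕ) then
        2 * (cc n m k + 1) * (((xi n m i - xi n m j) ^ 2)⁻¹
          + ((xi n m i + xi n m j) ^ 2)⁻¹) else 0) * z
  + (∑ i ∈ Finset.univ.filter (fun i : Fin (n + m) => (i : ℕ) < n),
      cc n m q * (cc n m q + 1) * ((xi n m i) ^ 2)⁻¹) * z
  + (∑ j ∈ Finset.univ.filter (fun j : Fin (n + m) => n ≤ (j : ℕ)),
      cc n m k * cc n m s * (cc n m s + 1) * ((xi n m j) ^ 2)⁻¹) * z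

end

theorem eq_zero_of_lie_of_iterate_lie_eq_zero {𝕜 A : Type*} [Field 𝕜] [CharZero 𝕜] [LieRing A]
    [LieAlgebra 𝕜 A] {H X C : A} {N : ℕ} (hC : ⁅H, C⁆ = 0)
    (hX : ⁅⁅H, X⁆, X⁆ = (-8 : 𝕜) • X) (hN : ⁅⁅H, X⁆, C⁆ = (4 * N : 𝕜) • C)
    (hnil : (fun D => ⁅X, D⁆)^[N] C = 0) : C = 0 := by
  have weight : ∀ j : ℕ, ⁅⁅H, X⁆, (fun D => ⁅X, D⁆)^[j] C⁆
      = (4 * N - 8 * j : 𝕜) • (fun D => ⁅X, D⁆)^[j] C := by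
    intro j
    induction j with
    | zero => simpa using hN
    | succ j ih =>
      rw [Function.iterate_succ_apply', leibniz_lie, hX, ih, smul_lie, lie_smul, ← add_smul]
      congr 1
      push_cast
      ring
  have lower : ∀ j : ℕ, ⁅H, (fun D => ⁅X, D⁆)^[j + 1] C⁆
      = (4 * (j + 1) * (N - j) : 𝕜) • (fun D => ⁅X, D⁆)^[j] C := by
    intro j
    induction j with
    | zero =>
      simp only [Function.iterate_succ_apply', Function.iterate_zero, id]
      rw [leibniz_lie, hN, hC, lie_zero, add_zero]
      simp
    | succ j ih =>
      rw [Function.iterate_succ_apply', leibniz_lie, weight, ih, lie_smul,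
        ← Function.iterate_succ_apply' (fun D => ⁅X, D⁆), ← add_smul]
      congr 1
      push_cast
      ring
  have descend : ∀ j : ℕ, j ≤ N → (fun D => ⁅X, D⁆)^[j] C = 0 → C = 0 := by
    intro j
    induction j with
    | zero => exact fun _ h => h
    | succ j ih =>
      intro hj h
      refine ih (by omega) ?_
      have h' := lower j
      rw [h, lie_zero, eq_comm, smul_eq_zero] at h'
      refine h'.resolve_left (mul_ne_zero (by norm_cast) ?_)
      rw [sub_ne_zero]
      exact_mod_cast (show N ≠ j by omega)
  exact descend N le_rfl hnil

attribute [local instance] LieRing.ofAssociativeRing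

/-- Elements of `R` which land in the image of `μ` after `r` brackets with `X`. -/
def IsLieOrder {K R : Type*} [CommRing K] [Ring R] (μ : K →+* R) (X : R) : ℕ → R → Prop
  | 0, D => ∃ f : K, D = μ f
  | r + 1, D => IsLieOrder μ X r ⁅X, D⁆

namespace IsLieOrder

variable {K R : Type*} [CommRing K] [Ring R] {μ : K →+* R} {g : K} {D D' : R}

theorem zero {X : R} (r : ℕ) : IsLieOrder μ X r 0 := by
  induction r with
  | zero => exact ⟨0, by simp⟩
  | succ r ih => rwa [IsLieOrder, lie_zero]

theorem add {X : R} {r : ℕ} (h : IsLieOrder μ X r D) (h' : IsLieOrder μ X r D') :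
    IsLieOrder μ X r (D + D') := by
  induction r generalizing D D' with
  | zero =>
    obtain ⟨f, rfl⟩ := h
    obtain ⟨g, rfl⟩ := h'
    exact ⟨f + g, by simp⟩
  | succ r ih =>
    rw [IsLieOrder, lie_add]
    exact ih h h'

theorem sum {X : R} {ι : Type*} (s : Finset ι) {T : ι → R} {r : ℕ}
    (h : ∀ i ∈ s, IsLieOrder μ X r (T i)) : IsLieOrder μ X r (∑ i ∈ s, T i) :=
  Finset.sum_induction T (IsLieOrder μ X r) (fun _ _ => add) (zero r) h

theorem lie_map (g f : K) : ⁅μ g, μ f⁆ = 0 := by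
  rw [Ring.lie_def, ← map_mul, ← map_mul, mul_comm, sub_self]

theorem mul {r t : ℕ} (h : IsLieOrder μ (μ g) r D) (h' : IsLieOrder μ (μ g) t D') :
    IsLieOrder μ (μ g) (r + t) (D * D') := by
  have leib : ∀ P Q : R, ⁅μ g, P * Q⁆ = ⁅μ g, P⁆ * Q + P * ⁅μ g, Q⁆ := fun P Q => by
    simp only [Ring.lie_def, mul_sub, sub_mul, mul_assoc]; abel
  induction hN : r + t generalizing r t D D' with
  | zero =>
    obtain ⟨rfl, rfl⟩ : r = 0 ∧ t = 0 := by omega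
    obtain ⟨f, rfl⟩ := h
    obtain ⟨g, rfl⟩ := h'
    exact ⟨f * g, (map_mul _ _ _).symm⟩
  | succ N ih =>
    rw [IsLieOrder, leib]
    refine add ?_ ?_
    · cases r with
      | zero =>
        obtain ⟨f, rfl⟩ := h
        simpa [lie_map] using zero N
      | succ r => exact ih (r := r) (t := t) h h' (by omega)
    · cases t with
      | zero =>
        obtain ⟨f, rfl⟩ := h'
        simpa [lie_map] using zero N
      | succ t => exact ih (r := r) (t := t) h h' (by omega)

theorem iterate_lie_lie_eq_zero {r t : ℕ} (h : IsLieOrder μ (μ g) r D)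
    (h' : IsLieOrder μ (μ g) t D') : (fun P => ⁅μ g, P⁆)^[r + t] ⁅D, D'⁆ = 0 := by
  have it_zero : ∀ N, (fun P => ⁅μ g, P⁆)^[N] (0 : R) = 0 := fun N =>
    Function.iterate_fixed (lie_zero (μ g)) N
  have it_add : ∀ N (P Q : R), (fun P => ⁅μ g, P⁆)^[N] (P + Q)
      = (fun P => ⁅μ g, P⁆)^[N] P + (fun P => ⁅μ g, P⁆)^[N] Q := by
    intro N
    induction N with
    | zero => simp
    | succ N ih => simp [ih]
  induction hN : r + t generalizing r t D D' with
  | zero =>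
    obtain ⟨rfl, rfl⟩ : r = 0 ∧ t = 0 := by omega
    obtain ⟨f, rfl⟩ := h
    obtain ⟨f', rfl⟩ := h'
    exact lie_map f f'
  | succ N ih =>
    rw [Function.iterate_succ_apply, leibniz_lie, it_add]
    have h₁ : (fun P => ⁅μ g, P⁆)^[N] ⁅⁅μ g, D⁆, D'⁆ = 0 := by
      cases r with
      | zero =>
        obtain ⟨f, rfl⟩ := h
        rw [lie_map, zero_lie, it_zero]
      | succ r => exact ih (r := r) (t := t) h h' (by omega)
    have h₂ : (fun P => ⁅μ g, P⁆)^[N] ⁅D, ⁅μ g, D'⁆⁆ = 0 := by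
      cases t with
      | zero =>
        obtain ⟨f, rfl⟩ := h'
        rw [lie_map, lie_zero, it_zero]
      | succ t => exact ih (r := r) (t := t) h h' (by omega)
    rw [h₁, h₂, add_zero]

end IsLieOrder

attribute [local instance] LieAlgebra.ofAssociativeAlgebra

theorem commute_of_homogeneous_of_isLieOrder {𝕜 K R : Type*} [Field 𝕜] [CharZero 𝕜] [CommRing K]
    [Ring R] [Algebra 𝕜 R] {μ : K →+* R} {g : K} {H E P Q : R} {c : 𝕜} {r t : ℕ}
    (hH : ⁅H, μ g⁆ = (-4 : 𝕜) • E + c • (1 : R)) (hE : ⁅E, μ g⁆ = (2 : 𝕜) • μ g)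
    (hHP : Commute H P) (hHQ : Commute H Q)
    (hEP : ⁅E, P⁆ = (-r : 𝕜) • P) (hEQ : ⁅E, Q⁆ = (-t : 𝕜) • Q)
    (hP : IsLieOrder μ (μ g) r P) (hQ : IsLieOrder μ (μ g) t Q) : Commute P Q := by
  have one_lie : ∀ D : R, ⁅(1 : R), D⁆ = 0 := fun D => by simp [Ring.lie_def]
  have lie_smul_right : ∀ (a : 𝕜) (D D' : R), ⁅D, a • D'⁆ = a • ⁅D, D'⁆ := fun a D D' => by
    simp only [Ring.lie_def, mul_smul_comm, smul_mul_assoc, smul_sub]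
  rw [commute_iff_lie_eq] at hHP hHQ ⊢
  refine eq_zero_of_lie_of_iterate_lie_eq_zero (𝕜 := 𝕜) (N := r + t) (H := H) (X := μ g)
    ?_ ?_ ?_ (hP.iterate_lie_lie_eq_zero hQ)
  · rw [leibniz_lie, hHP, hHQ, zero_lie, lie_zero, add_zero]
  · rw [hH, add_lie, smul_lie, smul_lie, one_lie, hE, smul_zero, add_zero, smul_smul]
    norm_num
  · rw [hH, add_lie, smul_lie, smul_lie, one_lie, leibniz_lie, hEP, hEQ, smul_zero, add_zero,
      smul_lie, lie_smul_right, ← add_smul, smul_smul]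
    congr 1
    push_cast
    ring

/-- Data `(∂, x, w, κ, g, v, U)` in a field for which the Moser matrix of type `B` with
diagonal entries `± w i ∂ i` and off-diagonal entries `κ j / (± x i ± x j)`, `± g i / x i`
admits a Lax partner, the Hamiltonian being `-∑ w i ∂ i ^ 2 + U`. -/
structure MoserSystem (𝕜 N K : Type*) [Field 𝕜] [Fintype N] [DecidableEq N] [Field K]
    [Algebra 𝕜 K] where
  d : N → Derivation 𝕜 K K
  x : N → K
  w : N → K
  κ : N → K
  g : N → K
  v : N → K
  U : K
  d_x : ∀ i j, d i (x j) = if i = j then 1 else 0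
  d_comm : ∀ i j z, d i (d j z) = d j (d i z)
  d_w : ∀ i j, d i (w j) = 0
  d_κ : ∀ i j, d i (κ j) = 0
  d_g : ∀ i j, d i (g j) = 0
  d_v : ∀ i j, d i (v j) = 0
  w_ne_zero : ∀ i, w i ≠ 0
  sub_ne_zero : ∀ i j, i ≠ j → x i - x j ≠ 0
  add_ne_zero : ∀ i j, x i + x j ≠ 0
  w_add_κ : ∀ i j, w i + κ i = w j + κ j
  two_g_sub_κ : ∀ i j, 2 * g i - κ i = 2 * g j - κ j
  v_mul_κ : ∀ i j, v i * κ j = v j * κ i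
  d_U : ∀ i, w i * d i U = ∑ j, (if j = i then 0 else
      -4 * κ j * (w i + κ i) * (((x i - x j) ^ 3)⁻¹ + ((x i + x j) ^ 3)⁻¹))
    - 2 * g i * (w i + g i) * ((x i) ^ 3)⁻¹

namespace MoserSystem

open Matrix Sum

variable {𝕜 N K : Type*} [Field 𝕜] [Fintype N] [DecidableEq N] [Field K]
  [Algebra 𝕜 K] (S : MoserSystem 𝕜 N K)

/-- The index underlying a signed index. -/
def ix : N ⊕ N → N := Sum.elim id id

/-- The signed coordinates `x i`, `-x i`. -/
def y : N ⊕ N → K := Sum.elim S.x (-S.x)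

/-- The signed derivations `∂ i`, `-∂ i`. -/
def D : N ⊕ N → Derivation 𝕜 K K := Sum.elim S.d (-S.d)

/-- The numerators of the off-diagonal entries of the Moser matrix. -/
def c (a b : N ⊕ N) : K := if b = a.swap then 2 * S.g (ix a) else S.κ (ix b)

/-- The off-diagonal part of the Moser matrix. -/
def Λ : Matrix (N ⊕ N) (N ⊕ N) K := of fun a b => S.c a b * (S.y a - S.y b)⁻¹

/-- The off-diagonal part of the Lax partner. -/
def Γ : Matrix (N ⊕ N) (N ⊕ N) K := of fun a b => -2 * S.c a b * ((S.y a - S.y b)⁻¹) ^ 2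

/-- The Lax partner, whose rows sum to zero. -/
def M : Matrix (N ⊕ N) (N ⊕ N) K := S.Γ - diagonal fun a => ∑ b, S.Γ a b

omit [Fintype N] [DecidableEq N] in
@[simp] theorem ix_swap (a : N ⊕ N) : ix a.swap = ix a := by cases a <;> rfl

omit [Fintype N] [DecidableEq N] in
theorem swap_ne (a : N ⊕ N) : a.swap ≠ a := by cases a <;> simp

omit [Fintype N] [DecidableEq N] in
theorem swap_eq_iff {a b : N ⊕ N} : a.swap = b ↔ a = b.swap :=
  ⟨fun h => by simp [← h], fun h => by simp [h]⟩

@[simp] theorem y_swap (a : N ⊕ N) : S.y a.swap = -S.y a := by cases a <;> simp [y]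

@[simp] theorem D_swap (a : N ⊕ N) : S.D a.swap = -S.D a := by cases a <;> simp [D]

theorem y_sub_ne_zero {a b : N ⊕ N} (h : a ≠ b) : S.y a - S.y b ≠ 0 := by
  rcases a with i | i <;> rcases b with j | j
  · simpa [y] using S.sub_ne_zero i j (by simpa using h)
  · simpa [y] using S.add_ne_zero i j
  · have := S.add_ne_zero i j
    contrapose! this
    simp only [y, elim_inl, elim_inr, Pi.neg_apply] at this
    linear_combination -this
  · have := S.sub_ne_zero i j (by simpa using h)
    contrapose! this
    simp only [y, elim_inr, Pi.neg_apply] at this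
    linear_combination -this

theorem y_add_ne_zero {a b : N ⊕ N} (h : b ≠ a.swap) : S.y a + S.y b ≠ 0 := by
  have := S.y_sub_ne_zero (a := a) (b := b.swap) (fun h' => h (by simp [h']))
  simpa using this

theorem y_ne_zero [NeZero (2 : K)] (a : N ⊕ N) : S.y a ≠ 0 := fun h =>
  S.y_add_ne_zero (swap_ne a).symm (by simp [h])

theorem D_y (a b : N ⊕ N) : S.D a (S.y b) = if b = a then 1 else if b = a.swap then -1 else 0 := by
  rcases a with i | i <;> rcases b with j | j <;>
    simp only [D, y, elim_inl, elim_inr, Pi.neg_apply, map_neg, Derivation.neg_apply, S.d_x,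
      swap_inl, swap_inr, inl.injEq, inr.injEq, reduceCtorEq, if_false, @eq_comm _ j i] <;>
    split_ifs <;> simp

theorem sum_w_d_y (a : N ⊕ N) (z : K) :
    ∑ i, S.w i * (S.d i (S.y a) * S.d i z) = S.w (ix a) * S.D a z := by
  rcases a with j | j <;> simp [D, y, ix, S.d_x]

theorem c_swap_swap (a b : N ⊕ N) : S.c a.swap b.swap = S.c a b := by
  simp [c, swap_eq_iff]

theorem c_self_swap (a : N ⊕ N) : S.c a a.swap = 2 * S.g (ix a) := by simp [c]

theorem c_swap_self (a : N ⊕ N) : S.c a.swap a = 2 * S.g (ix a) := by simp [c]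

theorem c_of_ne {a b : N ⊕ N} (h : b ≠ a.swap) : S.c a b = S.κ (ix b) := by simp [c, h]

@[simp] theorem d_c (i : N) (a b : N ⊕ N) : S.d i (S.c a b) = 0 := by
  rw [c]
  split_ifs
  · have : (2 : K) * S.g (ix a) = (2 : ℕ) • S.g (ix a) := by simp
    rw [this, map_nsmul, S.d_g, smul_zero]
  · exact S.d_κ _ _

@[simp] theorem D_c (e a b : N ⊕ N) : S.D e (S.c a b) = 0 := by
  rcases e with i | i <;> simp [D]

@[simp] theorem D_w (e : N ⊕ N) (i : N) : S.D e (S.w i) = 0 := by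
  rcases e with j | j <;> simp [D, S.d_w]

@[simp] theorem Γ_self (a : N ⊕ N) : S.Γ a a = 0 := by simp [Γ]

@[simp] theorem Λ_self (a : N ⊕ N) : S.Λ a a = 0 := by simp [Λ]

/-- The summands of the entries of the bracket of `Λ` and `M`. -/
def T (a b e : N ⊕ N) : K :=
  S.Λ a e * S.Γ e b - S.Γ a e * S.Λ e b + S.Λ a b * (S.Γ a e - S.Γ b e)

theorem Λ_mul_M_sub (a b : N ⊕ N) : (S.Λ * S.M - S.M * S.Λ) a b = ∑ e, S.T a b e := by
  simp only [M, mul_sub, sub_mul, Matrix.sub_apply, mul_diagonal, diagonal_mul]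
  simp only [T, mul_apply, Finset.sum_add_distrib, Finset.sum_sub_distrib, mul_sub,
    ← Finset.mul_sum]
  ring

theorem T_eq_zero {a b e : N ⊕ N} (hab : b ≠ a) (hea : e ≠ a) (heb : e ≠ b)
    (hab' : b ≠ a.swap) (hea' : e ≠ a.swap) (heb' : e ≠ b.swap) : S.T a b e = 0 := by
  have h₁ := S.y_sub_ne_zero hab.symm
  have h₂ := S.y_sub_ne_zero hea.symm
  have h₃ := S.y_sub_ne_zero heb.symm
  have h₄ := S.y_sub_ne_zero heb
  have hbe' : b ≠ e.swap := fun h => heb' (by simp [h])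
  simp only [T, Λ, Γ, of_apply, S.c_of_ne hab', S.c_of_ne hea', S.c_of_ne heb', S.c_of_ne hbe']
  field_simp
  ring

omit [Fintype N] [DecidableEq N] [Algebra 𝕜 K] in
theorem exceptional_sum_identity {A B wa wb κa κb ga gb : K} (two : (2 : K) ≠ 0)
    (hA : A ≠ 0) (hB : B ≠ 0) (hs : A - B ≠ 0) (ht : A + B ≠ 0)
    (k₁ : wa + κa = wb + κb) (k₂ : 2 * ga - κa = 2 * gb - κb) :
    κb * (A - B)⁻¹ * (0 - -2 * κa * (B - A)⁻¹ ^ 2) + (κb * (A - B)⁻¹ * (-2 * κb * (A - B)⁻¹ ^ 2)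
      + ((2 * ga * (A + A)⁻¹ * (-2 * κb * (-A - B)⁻¹ ^ 2)
          - -2 * (2 * ga) * (A + A)⁻¹ ^ 2 * (κb * (-A - B)⁻¹)
          + κb * (A - B)⁻¹ * (-2 * (2 * ga) * (A + A)⁻¹ ^ 2 - -2 * κa * (B + A)⁻¹ ^ 2))
        + (κb * (A + B)⁻¹ * (-2 * (2 * gb) * (-B - B)⁻¹ ^ 2)
          - -2 * κb * (A + B)⁻¹ ^ 2 * (2 * gb * (-B - B)⁻¹)
          + κb * (A - B)⁻¹ * (-2 * κb * (A + B)⁻¹ ^ 2 - -2 * (2 * gb) * (B + B)⁻¹ ^ 2))))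
      = 2 * κb * (wb - wa) * (A - B)⁻¹ ^ 3 := by
  obtain rfl : κa = 2 * ga - 2 * gb + κb := by linear_combination -k₂
  obtain rfl : wb = wa + 2 * ga - 2 * gb := by linear_combination -k₁
  rw [show -A - B = -(A + B) by ring, show -B - B = -(2 * B) by ring, show B + B = 2 * B by ring,
    show A + A = 2 * A by ring, show B - A = -(A - B) by ring, add_comm B A]
  field_simp
  ring

theorem sum_T_of_ne [NeZero (2 : K)] {a b : N ⊕ N} (hab : b ≠ a) (hab' : b ≠ a.swap) :
    ∑ e, S.T a b e
      = 2 * S.c a b * (S.w (ix b) - S.w (ix a)) * ((S.y a - S.y b)⁻¹) ^ 3 := by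
  have hba' : a ≠ b.swap := fun h => hab' (by simp [h])
  have hsw : a.swap ≠ b.swap := by simpa [swap_eq_iff] using hab.symm
  rw [← Finset.sum_subset (Finset.subset_univ {a, b, a.swap, b.swap})]
  · rw [Finset.sum_insert, Finset.sum_insert, Finset.sum_pair hsw]
    · have e₁ : S.c a b.swap = S.κ (ix b) := by rw [S.c_of_ne hsw.symm, ix_swap]
      have e₂ : S.c b a.swap = S.κ (ix a) := by rw [S.c_of_ne hsw, ix_swap]
      have e₃ : S.c a.swap b = S.κ (ix b) := S.c_of_ne (by simpa using hab)
      have key := exceptional_sum_identity (NeZero.ne (2 : K)) (S.y_ne_zero a) (S.y_ne_zero b)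
        (S.y_sub_ne_zero hab.symm) (S.y_add_ne_zero hab') (S.w_add_κ (ix a) (ix b))
        (S.two_g_sub_κ (ix a) (ix b))
      simp only [T, Λ_self, Γ_self]
      simp only [Λ, Γ, of_apply, y_swap, c_self_swap, c_swap_self, S.c_of_ne hab', e₁, e₂, e₃,
        S.c_of_ne hba', sub_neg_eq_add]
      rw [← key]
      ring
    · simp [hab', (swap_ne b).symm]
    · simp [hab.symm, hba', (swap_ne a).symm]
  · intro e _ he
    simp only [Finset.mem_insert, Finset.mem_singleton, not_or] at he
    exact S.T_eq_zero hab he.1 he.2.1 hab' he.2.2.1 he.2.2.2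

theorem T_add_T_swap [NeZero (2 : K)] (a e : N ⊕ N) :
    S.T a a.swap e + S.T a a.swap e.swap = 0 := by
  have two := NeZero.ne (2 : K)
  have h₀ := S.y_ne_zero a
  by_cases hea : e = a
  · subst hea
    simp only [T, Λ_self, Γ_self]
    simp only [Λ, Γ, of_apply, y_swap, c_self_swap, c_swap_self]
    rw [show -S.y e - S.y e = -(S.y e - -S.y e) by ring]
    simp only [inv_neg, neg_sq]
    ring
  by_cases hea' : e = a.swap
  · subst hea'
    simp only [T, Λ_self, Γ_self, swap_swap]
    simp only [Λ, Γ, of_apply, y_swap, c_self_swap, c_swap_self]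
    rw [show -S.y a - S.y a = -(S.y a - -S.y a) by ring]
    simp only [inv_neg, neg_sq]
    ring
  have h₁ := S.y_sub_ne_zero (Ne.symm hea)
  have h₂ := S.y_add_ne_zero hea'
  have n₁ : e.swap ≠ a.swap := by simpa [swap_eq_iff] using hea
  have n₂ : e.swap ≠ a := by simpa [swap_eq_iff] using hea'
  have e₁ : S.c a e.swap = S.κ (ix e) := by rw [S.c_of_ne n₁, ix_swap]
  have e₂ : S.c e a.swap = S.κ (ix a) := by rw [S.c_of_ne n₁.symm, ix_swap]
  have e₃ : S.c a.swap e.swap = S.κ (ix e) := by rw [c_swap_swap, S.c_of_ne hea']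
  have e₄ : S.c e.swap a.swap = S.κ (ix a) := by
    rw [c_swap_swap, S.c_of_ne (Ne.symm n₂)]
  have e₅ : S.c a.swap e = S.κ (ix e) := S.c_of_ne (by simpa using hea)
  simp only [T, Λ, Γ, of_apply, y_swap, c_self_swap, S.c_of_ne hea', e₁, e₂, e₃, e₄, e₅]
  rw [show -S.y a - S.y e = -(S.y a + S.y e) by ring, show -S.y e - -S.y a = S.y a - S.y e by ring,
    show S.y e - -S.y a = S.y a + S.y e by ring, show -S.y a - -S.y e = -(S.y a - S.y e) by ring,
    show S.y a - -S.y e = S.y a + S.y e by ring, show S.y a - -S.y a = 2 * S.y a by ring]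
  field_simp
  ring

theorem sum_T_swap [NeZero (2 : K)] (a : N ⊕ N) : ∑ e, S.T a a.swap e = 0 := by
  have h : ∑ e, S.T a a.swap e = ∑ e : N ⊕ N, S.T a a.swap e.swap :=
    ((Equiv.sumComm N N).sum_comp fun e => S.T a a.swap e).symm
  have h' : 2 * ∑ e, S.T a a.swap e = 0 := by
    rw [two_mul]
    nth_rewrite 2 [h]
    rw [← Finset.sum_add_distrib]
    exact Finset.sum_eq_zero fun e _ => S.T_add_T_swap a e
  exact (mul_eq_zero.mp h').resolve_left (NeZero.ne 2)

theorem D_D_y (i : N) (a : N ⊕ N) : S.d i (S.d i (S.y a)) = 0 := by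
  rcases a with j | j <;> simp [y, S.d_x, apply_ite (S.d i)]

theorem w_mul_D_U [NeZero (2 : K)] (a : N ⊕ N) :
    S.w (ix a) * S.D a S.U = ∑ e, -4 * S.c a e * (S.w (ix a) * S.D a (S.y a - S.y e) + S.c e a)
      * ((S.y a - S.y e)⁻¹) ^ 3 := by
  have key : ∀ i, S.w i * S.d i S.U = ∑ e, -4 * S.c (inl i) e
      * (S.w i * S.D (inl i) (S.y (inl i) - S.y e) + S.c e (inl i))
      * ((S.y (inl i) - S.y e)⁻¹) ^ 3 := by
    intro i
    have hx := S.add_ne_zero i i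
    rw [Fintype.sum_sum_type, ← Finset.sum_add_distrib, S.d_U, sub_eq_iff_eq_add,
      ← Finset.sum_erase_add _ _ (Finset.mem_univ i),
      ← Finset.sum_erase_add _ _ (Finset.mem_univ i), if_pos rfl, add_zero, add_assoc]
    refine (add_zero _).symm.trans
      (congrArg₂ (· + ·) (Finset.sum_congr rfl fun j hj => ?_) ?_)
    · have hj : j ≠ i := (Finset.mem_erase.mp hj).1
      simp [y, c, D, ix, S.d_x, hj, hj.symm]
      ring
    · have two := NeZero.ne (2 : K)
      have hx' : S.x i ≠ 0 := S.y_ne_zero (inl i)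
      simp only [y, c, D, ix, S.d_x, elim_inl, elim_inr, swap_inl, swap_inr, Pi.neg_apply, id,
        sub_self, _root_.inv_zero, sub_neg_eq_add, map_add, if_true]
      rw [← two_mul (S.x i)]
      field_simp
      ring
  rcases a with i | i
  · exact key i
  · have h := key i
    rw [← (Equiv.sumComm N N).sum_comp] at h
    have hD : S.D (inr i) = -S.D (inl i) := S.D_swap (inl i)
    have hy : S.y (inr i) = -S.y (inl i) := S.y_swap (inl i)
    have hc : ∀ e : N ⊕ N, S.c (inr i) e = S.c (inl i) e.swap := fun e => by
      rw [← c_swap_swap]; rfl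
    have hc' : ∀ e : N ⊕ N, S.c e (inr i) = S.c e.swap (inl i) := fun e => by
      rw [← c_swap_swap]; rfl
    calc S.w i * S.D (inr i) S.U = -(S.w i * S.d i S.U) := by simp [D]
      _ = _ := by
        rw [h, ← Finset.sum_neg_distrib]
        refine Finset.sum_congr rfl fun e _ => ?_
        simp only [hD, hy, hc, hc', Equiv.sumComm_apply, y_swap, sub_neg_eq_add,
          Derivation.neg_apply, map_sub, map_neg, map_add]
        rw [show -S.y (inl i) - S.y e = -(S.y (inl i) + S.y e) by ring, inv_neg]
        simp only [ix, elim_inr, id]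
        ring

/-- Multiplication operators, as a ring homomorphism. -/
def mulHom (𝕜 K : Type*) [Field 𝕜] [Field K] [Algebra 𝕜 K] : K →+* Module.End 𝕜 K :=
  (Algebra.lmul 𝕜 K).toRingHom

omit [Fintype N] [DecidableEq N] in
@[simp] theorem mulHom_apply (f z : K) : mulHom 𝕜 K f z = f * z := rfl

/-- The Hamiltonian. -/
def H : Module.End 𝕜 K :=
  mulHom 𝕜 K S.U - ∑ i, mulHom 𝕜 K (S.w i) * ((S.d i : K →ₗ[𝕜] K) * (S.d i : K →ₗ[𝕜] K) :
    Module.End 𝕜 K)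

theorem H_apply (z : K) : S.H z = S.U * z - ∑ i, S.w i * S.d i (S.d i z) := by
  simp [H, LinearMap.sum_apply]

theorem H_mul (f z : K) :
    S.H (f * z) = f * S.H z - (∑ i, S.w i * S.d i (S.d i f)) * z
      - 2 * ∑ i, S.w i * (S.d i f * S.d i z) := by
  simp only [H_apply, Derivation.leibniz, map_add, smul_eq_mul, mul_sub, Finset.mul_sum,
    Finset.sum_mul, sub_sub, ← Finset.sum_add_distrib]
  rw [mul_left_comm]
  congr 1
  refine Finset.sum_congr rfl fun i _ => ?_
  ring

theorem H_mul_of_const {f : K} (hf : ∀ i, S.d i f = 0) (z : K) : S.H (f * z) = f * S.H z := by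
  simp [H_mul, hf]

theorem D_inv_y_sub (e a b : N ⊕ N) :
    S.D e ((S.y a - S.y b)⁻¹) = -((S.y a - S.y b)⁻¹) ^ 2 * S.D e (S.y a - S.y b) := by
  rw [Derivation.leibniz_inv, smul_eq_mul]

theorem H_inv_y_sub_mul (a b : N ⊕ N) (z : K) :
    S.H ((S.y a - S.y b)⁻¹ * z) = (S.y a - S.y b)⁻¹ * S.H z
      - 2 * ((S.y a - S.y b)⁻¹) ^ 3 * (S.w (ix a) * S.D a (S.y a - S.y b)
        - S.w (ix b) * S.D b (S.y a - S.y b)) * z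
      + 2 * ((S.y a - S.y b)⁻¹) ^ 2 * (S.w (ix a) * S.D a z - S.w (ix b) * S.D b z) := by
  have first : ∀ z, ∑ i, S.w i * (S.d i (S.y a - S.y b) * S.d i z)
      = S.w (ix a) * S.D a z - S.w (ix b) * S.D b z := fun z => by
    simp only [map_sub, sub_mul, mul_sub, Finset.sum_sub_distrib, sum_w_d_y]
  rw [H_mul]
  have h₁ : ∑ i, S.w i * (S.d i (S.y a - S.y b)⁻¹ * S.d i z) = -((S.y a - S.y b)⁻¹) ^ 2 *
      (S.w (ix a) * S.D a z - S.w (ix b) * S.D b z) := by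
    rw [← first, Finset.mul_sum]
    refine Finset.sum_congr rfl fun i _ => ?_
    rw [Derivation.leibniz_inv, smul_eq_mul]
    ring
  have h₂ : ∑ i, S.w i * S.d i (S.d i (S.y a - S.y b)⁻¹) = 2 * ((S.y a - S.y b)⁻¹) ^ 3 *
      (S.w (ix a) * S.D a (S.y a - S.y b) - S.w (ix b) * S.D b (S.y a - S.y b)) := by
    rw [← first, Finset.mul_sum]
    refine Finset.sum_congr rfl fun i _ => ?_
    simp only [Derivation.leibniz_inv, Derivation.leibniz, smul_eq_mul, map_sub, D_D_y, map_neg,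
      Derivation.leibniz_pow]
    ring
  rw [h₁, h₂]
  ring

/-- The Moser matrix. -/
def L : Matrix (N ⊕ N) (N ⊕ N) (Module.End 𝕜 K) :=
  diagonal (fun a => mulHom 𝕜 K (S.w (ix a)) * (S.D a : K →ₗ[𝕜] K)) + S.Λ.map (mulHom 𝕜 K)

/-- The operator matrix `H - M`, which commutes with the Moser matrix. -/
def laxH : Matrix (N ⊕ N) (N ⊕ N) (Module.End 𝕜 K) :=
  diagonal (fun _ => S.H) - S.M.map (mulHom 𝕜 K)

theorem lax_apply (a b : N ⊕ N) (z : K) : (S.L * S.laxH - S.laxH * S.L) a b z =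
    (if a = b then S.w (ix a) * S.D a (S.H z) - S.H (S.w (ix a) * S.D a z) else 0)
    + (S.Λ a b * S.H z - S.H (S.Λ a b * z))
    - (S.w (ix a) * S.D a (S.M a b * z) - S.M a b * (S.w (ix b) * S.D b z))
    - (S.Λ * S.M - S.M * S.Λ) a b * z := by
  simp only [L, laxH, add_mul, mul_add, mul_sub, sub_mul, ← Matrix.map_mul, Matrix.sub_apply,
    Matrix.add_apply, diagonal_mul_diagonal, diagonal_mul, mul_diagonal, Matrix.map_apply,
    LinearMap.sub_apply, LinearMap.add_apply, Module.End.mul_apply, mulHom_apply, diagonal_apply]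
  split_ifs <;> simp <;> ring

theorem M_of_ne {a b : N ⊕ N} (h : a ≠ b) : S.M a b = S.Γ a b := by
  simp [M, diagonal_apply_ne _ h]

theorem M_self (a : N ⊕ N) : S.M a a = -∑ b, S.Γ a b := by
  simp [M]

theorem D_Γ (e a b : N ⊕ N) :
    S.D e (S.Γ a b) = 4 * S.c a b * ((S.y a - S.y b)⁻¹) ^ 3 * S.D e (S.y a - S.y b) := by
  rw [Γ, of_apply, show ∀ z : K, -2 * S.c a b * z = (-2 : ℤ) • (S.c a b * z) from
    fun z => by simp [mul_assoc], map_zsmul]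
  simp only [Derivation.leibniz, Derivation.leibniz_pow, D_inv_y_sub, D_c, smul_eq_mul]
  simp [-inv_pow]
  ring

theorem L_mul_laxH [NeZero (2 : K)] : S.L * S.laxH = S.laxH * S.L := by
  rw [← sub_eq_zero]
  ext a b z
  rw [lax_apply, Λ_mul_M_sub, Matrix.zero_apply, LinearMap.zero_apply]
  by_cases hab : a = b
  · subst hab
    have hU : S.D a (S.H z) - S.H (S.D a z) = S.D a S.U * z := by
      have hcomm : ∀ i z, S.D a (S.d i z) = S.d i (S.D a z) := fun i z => by
        rcases a with j | j <;> simp [D, S.d_comm j i]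
      simp only [H_apply, map_sub, map_sum, Derivation.leibniz, hcomm, smul_eq_mul, D_w]
      simp only [mul_zero, add_zero]
      ring
    have hw : S.H (S.w (ix a) * S.D a z) = S.w (ix a) * S.H (S.D a z) :=
      S.H_mul_of_const (fun i => S.d_w _ _) _
    have hT : S.w (ix a) * S.D a S.U
        = S.w (ix a) * S.D a (S.M a a) + ∑ e, S.T a a e := by
      rw [w_mul_D_U, M_self, map_neg, map_sum, mul_neg, ← sub_eq_neg_add,
        Finset.mul_sum, ← Finset.sum_sub_distrib]
      refine Finset.sum_congr rfl fun e _ => ?_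
      rw [D_Γ]
      simp only [T, Λ, Γ, of_apply]
      rw [show S.y e - S.y a = -(S.y a - S.y e) by ring]
      simp only [inv_neg, neg_sq]
      ring
    rw [if_pos rfl, hw, ← mul_sub, hU, Λ_self, ← mul_assoc, hT]
    simp only [Derivation.leibniz, smul_eq_mul, zero_mul, map_zero]
    ring
  · rw [if_neg hab, M_of_ne _ hab]
    have hH : S.H (S.Λ a b * z) = S.c a b * S.H ((S.y a - S.y b)⁻¹ * z) := by
      rw [Λ, of_apply, mul_assoc, H_mul_of_const]
      simp
    have hD : S.D a (S.Γ a b * z) = S.Γ a b * S.D a z + z * S.D a (S.Γ a b) := by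
      simp
    rw [hH, H_inv_y_sub_mul, hD, D_Γ]
    by_cases hab' : b = a.swap
    · subst hab'
      rw [sum_T_swap]
      simp only [Λ, Γ, of_apply, D_swap, ix_swap, map_sub, D_y]
      simp [swap_ne, D_y]
      ring
    · rw [S.sum_T_of_ne (Ne.symm hab) hab']
      have hba' : a ≠ b.swap := fun h => hab' (by simp [h])
      simp only [Λ, Γ, of_apply, map_sub, D_y]
      simp [hab, Ne.symm hab, hab', hba']
      ring

theorem sum_M_right (a : N ⊕ N) : ∑ b, S.M a b = 0 := by
  simp [M, Finset.sum_sub_distrib, diagonal_apply]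

theorem v_mul_c (a b : N ⊕ N) : S.v (ix a) * S.c a b = S.v (ix b) * S.c b a := by
  by_cases h : b = a.swap
  · subst h
    rw [c_self_swap, c_swap_self, ix_swap]
  · rw [S.c_of_ne h, S.c_of_ne (fun h' => h (by simp [h'])), S.v_mul_κ]

theorem v_mul_Γ (a b : N ⊕ N) : S.v (ix a) * S.Γ a b = S.v (ix b) * S.Γ b a := by
  have h := S.v_mul_c a b
  simp only [Γ, of_apply]
  rw [show S.y b - S.y a = -(S.y a - S.y b) by ring, inv_neg, neg_sq]
  linear_combination -2 * ((S.y a - S.y b)⁻¹) ^ 2 * h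

theorem sum_v_mul_M (b : N ⊕ N) : ∑ a, S.v (ix a) * S.M a b = 0 := by
  simp only [M, Matrix.sub_apply, diagonal_apply, mul_sub, Finset.sum_sub_distrib, mul_ite,
    mul_zero, Finset.sum_ite_eq', Finset.mem_univ, if_true, Finset.mul_sum, S.v_mul_Γ _ b]
  exact sub_self _

/-- The deformed total trace of the `r`-th power of the Moser matrix. -/
def P (r : ℕ) : Module.End 𝕜 K := ∑ a, ∑ b, mulHom 𝕜 K (S.v (ix a)) * (S.L ^ r) a b

theorem sum_laxH_right (a : N ⊕ N) : ∑ b, S.laxH a b = S.H := by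
  simp [laxH, Finset.sum_sub_distrib, diagonal_apply, ← map_sum, sum_M_right, -Fintype.sum_sum_type]

theorem commute_H_mulHom_v (i : N) : Commute S.H (mulHom 𝕜 K (S.v i)) :=
  LinearMap.ext fun z => S.H_mul_of_const (fun j => S.d_v j i) z

theorem sum_v_mul_laxH (b : N ⊕ N) :
    ∑ a, mulHom 𝕜 K (S.v (ix a)) * S.laxH a b = mulHom 𝕜 K (S.v (ix b)) * S.H := by
  simp [laxH, Finset.sum_sub_distrib, diagonal_apply, mul_sub, ← map_mul, ← map_sum, sum_v_mul_M,
    -Fintype.sum_sum_type]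

theorem commute_H_P [NeZero (2 : K)] (r : ℕ) : Commute S.H (S.P r) := by
  have h : S.L ^ r * S.laxH = S.laxH * S.L ^ r :=
    (show Commute S.L S.laxH from S.L_mul_laxH).pow_left r
  calc S.H * S.P r
      = ∑ b, ∑ a, mulHom 𝕜 K (S.v (ix a)) * (S.laxH * S.L ^ r) a b := by
        simp only [P, Finset.mul_sum, ← mul_assoc, (S.commute_H_mulHom_v _).eq]
        rw [Finset.sum_comm]
        refine Finset.sum_congr rfl fun b _ => ?_
        simp only [← sum_v_mul_laxH, Finset.sum_mul, mul_apply, Finset.mul_sum]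
        rw [Finset.sum_comm]
        simp only [mul_assoc]
    _ = S.P r * S.H := by
        rw [Finset.sum_comm, ← h]
        simp only [P, Finset.sum_mul, mul_apply]
        refine Finset.sum_congr rfl fun a _ => ?_
        simp only [Finset.mul_sum]
        rw [Finset.sum_comm]
        refine Finset.sum_congr rfl fun b _ => ?_
        rw [← Finset.mul_sum, ← Finset.mul_sum, sum_laxH_right, mul_assoc]

/-- The Euler derivation. -/
def euler : Derivation 𝕜 K K := ∑ i, S.x i • S.d i

theorem euler_apply (z : K) : S.euler z = ∑ i, S.x i * S.d i z := by
  have := congrFun (map_sum (Derivation.coeFnAddMonoidHom (R := 𝕜) (A := K) (M := K))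
    (fun i => S.x i • S.d i) Finset.univ) z
  simpa only [euler, Derivation.coeFnAddMonoidHom_apply, Finset.sum_apply, Derivation.smul_apply,
    smul_eq_mul] using this

theorem euler_y (a : N ⊕ N) : S.euler (S.y a) = S.y a := by
  rcases a with j | j <;> simp [euler_apply, y, S.d_x]

theorem euler_D (a : N ⊕ N) (z : K) : S.euler (S.D a z) = S.D a (S.euler z) - S.D a z := by
  have key : ∀ j, S.euler (S.d j z) = S.d j (S.euler z) - S.d j z := fun j => by
    simp [euler_apply, S.d_x, Finset.sum_add_distrib, S.d_comm j]
  rcases a with j | j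
  · exact key j
  · simp only [D, elim_inr, Pi.neg_apply, Derivation.neg_apply, map_neg, key]
    ring

theorem lie_euler_mulHom (f : K) :
    ⁅(S.euler : Module.End 𝕜 K), mulHom 𝕜 K f⁆ = mulHom 𝕜 K (S.euler f) := by
  ext z
  simp [Ring.lie_def, mul_comm z]

theorem lie_euler_L (a b : N ⊕ N) : ⁅(S.euler : Module.End 𝕜 K), S.L a b⁆ = -S.L a b := by
  ext z
  have hw : S.euler (S.w (ix a)) = 0 := by simp [euler_apply, S.d_w]
  have hc : S.euler (S.c a b) = 0 := by simp [euler_apply]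
  by_cases hab : a = b
  · subst hab
    simp [Ring.lie_def, L, hw, euler_D]
    ring
  · have h := S.y_sub_ne_zero hab
    have hΛ : S.euler (S.Λ a b) = -S.Λ a b := by
      simp only [Λ, of_apply, Derivation.leibniz, Derivation.leibniz_inv, hc, map_sub, euler_y,
        smul_eq_mul]
      field_simp
      simp
    simp [Ring.lie_def, L, diagonal_apply_ne _ hab, hΛ]
    ring

theorem lie_euler_L_pow (r : ℕ) (a b : N ⊕ N) :
    ⁅(S.euler : Module.End 𝕜 K), (S.L ^ r) a b⁆ = (-r : 𝕜) • (S.L ^ r) a b := by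
  have leib : ∀ (t : 𝕜) (E A B : Module.End 𝕜 K), ⁅E, A⁆ = t • A → ⁅E, B⁆ = -B →
      E * (A * B) - A * B * E = (t - 1) • (A * B) := fun t E A B hA hB => by
    rw [Ring.lie_def, sub_eq_iff_eq_add] at hA hB
    rw [← mul_assoc, hA, add_mul, mul_assoc _ E, hB, mul_add, sub_smul, one_smul, mul_neg,
      smul_mul_assoc, mul_assoc]
    abel
  induction r generalizing a b with
  | zero =>
    rw [pow_zero, Matrix.one_apply]
    split_ifs <;> simp [Ring.lie_def]
  | succ r ih =>
    rw [pow_succ, mul_apply, Ring.lie_def, Finset.mul_sum, Finset.sum_mul, Finset.smul_sum,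
      ← Finset.sum_sub_distrib]
    refine Finset.sum_congr rfl fun e _ => ?_
    rw [leib _ _ _ _ (ih a e) (S.lie_euler_L e b)]
    congr 1
    push_cast
    ring

theorem lie_euler_P (r : ℕ) : ⁅(S.euler : Module.End 𝕜 K), S.P r⁆ = (-r : 𝕜) • S.P r := by
  rw [P, Ring.lie_def, Finset.mul_sum, Finset.sum_mul, Finset.smul_sum, ← Finset.sum_sub_distrib]
  refine Finset.sum_congr rfl fun a _ => ?_
  rw [Finset.mul_sum, Finset.sum_mul, Finset.smul_sum, ← Finset.sum_sub_distrib]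
  refine Finset.sum_congr rfl fun b _ => ?_
  have hv : Commute (S.euler : Module.End 𝕜 K) (mulHom 𝕜 K (S.v (ix a))) := by
    ext z
    simp [euler_apply, S.d_v, Finset.mul_sum, mul_left_comm]
  rw [← mul_assoc, hv.eq, mul_assoc, mul_assoc, ← mul_sub, ← Ring.lie_def, lie_euler_L_pow,
    mul_smul_comm]

/-- The weighted squared norm `∑ x i ^ 2 / w i`. -/
def normSq : K := ∑ i, S.x i ^ 2 * (S.w i)⁻¹

theorem d_normSq (i : N) : S.d i S.normSq = 2 * S.x i * (S.w i)⁻¹ := by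
  have hw : ∀ j, S.d i (S.w j)⁻¹ = 0 := fun j => by simp [Derivation.leibniz_inv, S.d_w]
  simp [normSq, Derivation.leibniz_pow, hw, S.d_x]
  ring

theorem isLieOrder_L (a b : N ⊕ N) :
    IsLieOrder (mulHom 𝕜 K) (mulHom 𝕜 K S.normSq) 1 (S.L a b) := by
  by_cases hab : a = b
  · subst hab
    refine ⟨-(S.w (ix a) * S.D a S.normSq), ?_⟩
    ext z
    simp [Ring.lie_def, L]
    ring
  · refine ⟨0, ?_⟩
    rw [L, Matrix.add_apply, diagonal_apply_ne _ hab, zero_add, Matrix.map_apply,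
      IsLieOrder.lie_map, map_zero]

theorem isLieOrder_L_pow (r : ℕ) (a b : N ⊕ N) :
    IsLieOrder (mulHom 𝕜 K) (mulHom 𝕜 K S.normSq) r ((S.L ^ r) a b) := by
  induction r generalizing a b with
  | zero => exact ⟨(1 : Matrix (N ⊕ N) (N ⊕ N) K) a b, by
      rw [pow_zero, Matrix.one_apply, Matrix.one_apply]; split_ifs <;> simp⟩
  | succ r ih =>
    rw [pow_succ, mul_apply]
    exact IsLieOrder.sum _ fun e _ => (ih a e).mul (S.isLieOrder_L e b)

theorem isLieOrder_P (r : ℕ) : IsLieOrder (mulHom 𝕜 K) (mulHom 𝕜 K S.normSq) r (S.P r) :=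
  IsLieOrder.sum _ fun a _ => IsLieOrder.sum _ fun b _ => by
    have h : IsLieOrder (mulHom 𝕜 K) (mulHom 𝕜 K S.normSq) 0 (mulHom 𝕜 K (S.v (ix a))) := ⟨_, rfl⟩
    simpa using h.mul (S.isLieOrder_L_pow r a b)

theorem lie_H_normSq : ⁅S.H, mulHom 𝕜 K S.normSq⁆
    = (-4 : 𝕜) • (S.euler : Module.End 𝕜 K) + (-2 * Fintype.card N : 𝕜) • (1 : Module.End 𝕜 K) := by
  ext z
  have h₁ : ∑ i, S.w i * (S.d i S.normSq * S.d i z) = 2 * S.euler z := by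
    rw [euler_apply, Finset.mul_sum]
    refine Finset.sum_congr rfl fun i _ => ?_
    have := S.w_ne_zero i
    rw [d_normSq]
    field_simp
  have h₂ : ∑ i, S.w i * S.d i (S.d i S.normSq) = 2 * Fintype.card N := by
    have : ∀ i, S.w i * S.d i (S.d i S.normSq) = 2 := fun i => by
      have := S.w_ne_zero i
      rw [d_normSq, show 2 * S.x i * (S.w i)⁻¹ = (2 : ℕ) • (S.x i * (S.w i)⁻¹) by
        simp [mul_assoc], map_nsmul]
      simp [Derivation.leibniz_inv, S.d_w, S.d_x]
      field_simp
    simp [this, mul_comm]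
  simp only [Ring.lie_def, LinearMap.sub_apply, Module.End.mul_apply, mulHom_apply, H_mul, h₁, h₂,
    LinearMap.add_apply, Module.End.one_apply, Algebra.smul_def, map_neg,
    map_mul, map_ofNat, map_natCast]
  simp
  ring

theorem lie_euler_normSq : ⁅(S.euler : Module.End 𝕜 K), mulHom 𝕜 K S.normSq⁆
    = (2 : 𝕜) • mulHom 𝕜 K S.normSq := by
  have : S.euler S.normSq = 2 * S.normSq := by
    rw [euler_apply, normSq, Finset.mul_sum]
    refine Finset.sum_congr rfl fun i _ => ?_
    have := S.d_normSq i
    rw [normSq] at this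
    rw [this]
    ring
  rw [lie_euler_mulHom, this]
  ext z
  simp [Algebra.smul_def, map_ofNat (algebraMap 𝕜 K)]

theorem commute_P_P [CharZero 𝕜] (r t : ℕ) : Commute (S.P r) (S.P t) := by
  have : CharZero K := charZero_of_injective_algebraMap (algebraMap 𝕜 K).injective
  exact commute_of_homogeneous_of_isLieOrder S.lie_H_normSq S.lie_euler_normSq
    (S.commute_H_P r) (S.commute_H_P t) (S.lie_euler_P r) (S.lie_euler_P t)
    (S.isLieOrder_P r) (S.isLieOrder_P t)

end MoserSystem

noncomputable section

namespace RationalFunctions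

variable (n m : ℕ)

theorem emb_injective : Function.Injective (emb n m) := IsFractionRing.injective (PR n m) (F n m)

theorem emb_den_ne_zero (z : F n m) : emb n m (den n m z) ≠ 0 := by
  rw [emb, Ne, IsFractionRing.to_map_eq_zero_iff (K := F n m)]
  exact nonZeroDivisors.ne_zero (IsLocalization.sec (nonZeroDivisors (PR n m)) z).2.2

theorem emb_num (z : F n m) : emb n m (num n m z) = z * emb n m (den n m z) :=
  (IsLocalization.sec_spec (nonZeroDivisors (PR n m)) z).symm

variable {n m}

theorem emb_add (a b : PR n m) : emb n m (a + b) = emb n m a + emb n m b := map_add _ _ _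

theorem emb_mul (a b : PR n m) : emb n m (a * b) = emb n m a * emb n m b := map_mul _ _ _

theorem emb_zero : emb n m 0 = 0 := map_zero _

theorem emb_one : emb n m 1 = 1 := map_one _

/-- The quotient rule holds for every fraction representing `z`. -/
theorem fder_mul_emb (i : Fin (n + m)) {z : F n m} {a b : PR n m}
    (h : emb n m a = z * emb n m b) :
    fder n m i z * emb n m b = emb n m (pderiv i a) - z * emb n m (pderiv i b) := by
  have hd := emb_den_ne_zero n m z
  have hn := emb_num n m z
  have hpoly : num n m z * b = a * den n m z := emb_injective n m (by
    rw [emb_mul, emb_mul, hn, h]; ring)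
  have hder := congrArg (fun f => emb n m (pderiv i f)) hpoly
  simp only [Derivation.leibniz, smul_eq_mul, emb_add, emb_mul, hn, h] at hder
  rw [fder, hn]
  field_simp
  linear_combination hder

theorem fder_eq {i : Fin (n + m)} {z y : F n m} {a b : PR n m} (hb : emb n m b ≠ 0)
    (h : emb n m a = z * emb n m b)
    (h' : emb n m (pderiv i a) - z * emb n m (pderiv i b) = y * emb n m b) : fder n m i z = y :=
  mul_right_cancel₀ hb ((fder_mul_emb i h).trans h')

theorem fder_emb (i : Fin (n + m)) (a : PR n m) :
    fder n m i (emb n m a) = emb n m (pderiv i a) :=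
  fder_eq (a := a) (b := 1) (by simp [emb_one]) (by simp [emb_one]) (by simp [emb_one, emb_zero])

theorem exists_emb_eq (z : F n m) : ∃ a b : PR n m, emb n m b ≠ 0 ∧ emb n m a = z * emb n m b :=
  ⟨_, _, emb_den_ne_zero n m z, emb_num n m z⟩

theorem fder_add (i : Fin (n + m)) (y z : F n m) :
    fder n m i (y + z) = fder n m i y + fder n m i z := by
  obtain ⟨a, b, hb, h⟩ := exists_emb_eq y
  obtain ⟨a', b', hb', h'⟩ := exists_emb_eq z
  have e := fder_mul_emb i h
  have e' := fder_mul_emb i h'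
  refine fder_eq (a := a * b' + a' * b) (b := b * b') ?_ ?_ ?_
  · rw [emb_mul]; exact mul_ne_zero hb hb'
  · rw [emb_mul, emb_add, emb_mul, emb_mul, h, h']; ring
  · simp only [map_add, Derivation.leibniz, smul_eq_mul, emb_add, emb_mul, h, h']
    linear_combination -emb n m b' * e - emb n m b * e'

theorem fder_mul (i : Fin (n + m)) (y z : F n m) :
    fder n m i (y * z) = y * fder n m i z + z * fder n m i y := by
  obtain ⟨a, b, hb, h⟩ := exists_emb_eq y
  obtain ⟨a', b', hb', h'⟩ := exists_emb_eq z
  have e := fder_mul_emb i h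
  have e' := fder_mul_emb i h'
  refine fder_eq (a := a * a') (b := b * b') ?_ ?_ ?_
  · rw [emb_mul]; exact mul_ne_zero hb hb'
  · rw [emb_mul, emb_mul, h, h']; ring
  · simp only [Derivation.leibniz, smul_eq_mul, emb_add, emb_mul, h, h']
    linear_combination -z * emb n m b' * e - y * emb n m b * e'

theorem fder_cc (i : Fin (n + m)) (t : ℂ) : fder n m i (cc n m t) = 0 := by
  rw [cc, fder_emb, pderiv_C, emb_zero]

theorem algebraMap_eq_cc (t : ℂ) : algebraMap ℂ (F n m) t = cc n m t := by
  rw [IsScalarTower.algebraMap_apply ℂ (PR n m) (F n m)]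
  rfl

/-- The partial derivative `∂/∂x i` as a derivation of the field of rational functions. -/
def fderiv (i : Fin (n + m)) : Derivation ℂ (F n m) (F n m) :=
  Derivation.mk'
    { toFun := fder n m i
      map_add' := fder_add i
      map_smul' := fun t z => by
        simp [Algebra.smul_def, algebraMap_eq_cc, fder_mul, fder_cc] }
    (fun y z => fder_mul i y z)

@[simp] theorem fderiv_apply (i : Fin (n + m)) (z : F n m) : fderiv i z = fder n m i z := rfl

theorem fder_comm (i j : Fin (n + m)) (z : F n m) :
    fder n m i (fder n m j z) = fder n m j (fder n m i z) := by
  obtain ⟨a, b, hb, h⟩ := exists_emb_eq z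
  have hpd : ∀ f : PR n m, pderiv i (pderiv j f) = pderiv j (pderiv i f) := fun f => by
    have : ⁅(pderiv i : Derivation ℂ (PR n m) (PR n m)),
        (pderiv j : Derivation ℂ (PR n m) (PR n m))⁆ = 0 := by
      ext l
      simp [Derivation.commutator_apply, pderiv_X, Pi.single_apply, apply_ite]
    have := congrArg (fun D => D f) this
    simpa [Derivation.commutator_apply, sub_eq_zero] using this
  have key : ∀ l l' : Fin (n + m), fder n m l' (fder n m l z) * emb n m b
      = emb n m (pderiv l' (pderiv l a)) - fder n m l' z * emb n m (pderiv l b)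
        - z * emb n m (pderiv l' (pderiv l b)) - fder n m l z * emb n m (pderiv l' b) :=
    fun l l' => by
      have e := congrArg (fderiv l') (fder_mul_emb l h)
      simp only [Derivation.leibniz, map_sub, fderiv_apply, fder_emb, smul_eq_mul] at e
      linear_combination e
  refine mul_right_cancel₀ hb ?_
  rw [key, key, hpd a, hpd b]
  ring

theorem fder_xi (i j : Fin (n + m)) : fder n m i (xi n m j) = if i = j then 1 else 0 := by
  rw [xi, fder_emb, pderiv_X, Pi.single_apply]
  simp only [@eq_comm _ j i]
  split_ifs
  exacts [emb_one, emb_zero]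

theorem fder_cc_zpow (i : Fin (n + m)) (t : ℂ) (e : ℤ) : fder n m i (cc n m t ^ e) = 0 := by
  rw [show cc n m t ^ e = cc n m (t ^ e) by
    rw [← algebraMap_eq_cc, ← algebraMap_eq_cc, map_zpow₀], fder_cc]

theorem xi_sub_ne_zero {i j : Fin (n + m)} (h : i ≠ j) : xi n m i - xi n m j ≠ 0 := by
  rw [Ne, sub_eq_zero, xi, xi, (emb_injective n m).eq_iff,
    (MvPolynomial.X_injective (R := ℂ)).eq_iff]
  exact h

theorem xi_add_ne_zero (i j : Fin (n + m)) : xi n m i + xi n m j ≠ 0 := by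
  rw [xi, xi, ← emb_add, ← emb_zero, Ne, (emb_injective n m).eq_iff]
  intro h
  have := congrArg (MvPolynomial.eval fun _ : Fin (n + m) => (1 : ℂ)) h
  norm_num at this

theorem cc_ne_zero {t : ℂ} (ht : t ≠ 0) : cc n m t ≠ 0 := by
  rw [← algebraMap_eq_cc]
  simpa using ht

theorem cc_add (a b : ℂ) : cc n m (a + b) = cc n m a + cc n m b := by
  simp only [← algebraMap_eq_cc, map_add]

theorem cc_mul (a b : ℂ) : cc n m (a * b) = cc n m a * cc n m b := by
  simp only [← algebraMap_eq_cc, map_mul]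

theorem cc_one : cc n m 1 = 1 := by rw [← algebraMap_eq_cc, map_one]

theorem cc_two : cc n m 2 = 2 := by rw [← algebraMap_eq_cc, map_ofNat]

theorem pE_eq (i : Fin (n + m)) : pE n m i = 0 ∨ pE n m i = 1 := by
  rw [pE]; split_ifs <;> simp

theorem fder_one (l : Fin (n + m)) : fder n m l 1 = 0 := by rw [← cc_one, fder_cc]

theorem fder_two (l : Fin (n + m)) : fder n m l 2 = 0 := by rw [← cc_two, fder_cc]

variable (n m) in
/-- The pair part of the potential. -/
def pairPotential (k : ℂ) (i j : Fin (n + m)) : F n m :=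
  2 * cc n m k ^ (1 - pE n m i - pE n m j) * (cc n m k + 1)
    * (((xi n m i - xi n m j) ^ 2)⁻¹ + ((xi n m i + xi n m j) ^ 2)⁻¹)

variable (n m) in
/-- The potential of the deformed Calogero-Moser-Sutherland operator of type `B`. -/
def potential (k q s : ℂ) : F n m :=
  (∑ i, ∑ j, if i < j then pairPotential n m k i j else 0)
    + ∑ i, cc n m k ^ pE n m i * mult n m q s i * (mult n m q s i + 1) * (xi n m i ^ 2)⁻¹

theorem fder_mult (l i : Fin (n + m)) (q s : ℂ) : fder n m l (mult n m q s i) = 0 := by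
  rw [mult]; split_ifs <;> exact fder_cc _ _

theorem sum_lt_eq_of_symm {N R : Type*} [Fintype N] [LinearOrder N] [AddCommMonoid R]
    (l : N) (f : N → N → R) (hf : ∀ i j, f i j = f j i)
    (h : ∀ i j, i ≠ l → j ≠ l → f i j = 0) :
    (∑ i, ∑ j, if i < j then f i j else 0) = ∑ j, if j = l then 0 else f l j := by
  have key : ∀ i j, (if i < j then f i j else 0)
      = (if i = l then (if l < j then f l j else 0) else 0)
        + (if j = l then (if i < l then f l i else 0) else 0) := fun i j => by
    by_cases hi : i = l
    · subst hi
      by_cases hj : j = i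
      · simp [hj]
      · simp [hj]
    · by_cases hj : j = l
      · subst hj
        simp [hi, hf i j]
      · simp [hi, hj, h i j hi hj]
  rw [Finset.sum_congr rfl fun i _ => Finset.sum_congr rfl fun j _ => key i j]
  simp only [Finset.sum_add_distrib]
  rw [Finset.sum_comm]
  simp only [Finset.sum_ite_eq', Finset.mem_univ, if_true]
  rw [← Finset.sum_add_distrib]
  refine Finset.sum_congr rfl fun j _ => ?_
  rcases lt_trichotomy j l with hj | hj | hj
  · simp [hj, hj.ne, hj.not_gt]
  · simp [hj]
  · simp [hj, hj.ne', hj.not_gt]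

theorem fder_inv_sq (l : Fin (n + m)) (z : F n m) :
    fder n m l ((z ^ 2)⁻¹) = -2 * (z ^ 3)⁻¹ * fder n m l z := by
  by_cases hz : z = 0
  · subst hz
    simp [← fderiv_apply]
  rw [← fderiv_apply, Derivation.leibniz_inv, Derivation.leibniz_pow]
  simp only [fderiv_apply, smul_eq_mul, nsmul_eq_mul, Nat.cast_ofNat, pow_one,
    Nat.add_one_sub_one]
  field_simp

theorem fder_pairPotential (k : ℂ) (l i j : Fin (n + m)) :
    fder n m l (pairPotential n m k i j) = -4 * cc n m k ^ (1 - pE n m i - pE n m j)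
      * (cc n m k + 1) * (((xi n m i - xi n m j) ^ 3)⁻¹ * fder n m l (xi n m i - xi n m j)
        + ((xi n m i + xi n m j) ^ 3)⁻¹ * fder n m l (xi n m i + xi n m j)) := by
  have hconst : fder n m l (2 * cc n m k ^ (1 - pE n m i - pE n m j) * (cc n m k + 1)) = 0 := by
    simp only [fder_two, fder_one, fder_mul, fder_add, fder_cc, fder_cc_zpow]
    ring
  rw [pairPotential, fder_mul, hconst, fder_add, fder_inv_sq, fder_inv_sq]
  ring

theorem zpow_mul_fder_potential {k : ℂ} (hk : k ≠ 0) (q s : ℂ) (l : Fin (n + m)) :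
    cc n m k ^ pE n m l * fder n m l (potential n m k q s)
      = ∑ j, (if j = l then 0 else -4 * cc n m k ^ (1 - pE n m j) * (cc n m k + 1)
          * (((xi n m l - xi n m j) ^ 3)⁻¹ + ((xi n m l + xi n m j) ^ 3)⁻¹))
        - 2 * (cc n m k ^ pE n m l * mult n m q s l)
          * (cc n m k ^ pE n m l + cc n m k ^ pE n m l * mult n m q s l)
          * (xi n m l ^ 3)⁻¹ := by
  have hsub : ∀ i j, fder n m l (xi n m i - xi n m j)
      = (if l = i then 1 else 0) - if l = j then 1 else 0 := fun i j => by
    rw [← fder_xi, ← fder_xi, ← fderiv_apply, map_sub]; rfl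
  have hpair : fder n m l (∑ i, ∑ j, if i < j then pairPotential n m k i j else 0)
      = ∑ j, if j = l then 0 else fder n m l (pairPotential n m k l j) := by
    rw [← fderiv_apply, map_sum]
    simp only [map_sum, apply_ite (fderiv l), map_zero, fderiv_apply]
    refine sum_lt_eq_of_symm l (fun i j => fder n m l (pairPotential n m k i j))
      (fun i j => ?_) fun i j hi hj => ?_
    · simp only [pairPotential]
      rw [← neg_sub (xi n m i), neg_sq, add_comm (xi n m j), sub_right_comm]
    · simp [fder_pairPotential, hsub, fder_add, fder_xi, hi.symm, hj.symm]
  have hsingle : fder n m l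
      (∑ i, cc n m k ^ pE n m i * mult n m q s i * (mult n m q s i + 1) * (xi n m i ^ 2)⁻¹)
      = -2 * (cc n m k ^ pE n m l * mult n m q s l * (mult n m q s l + 1)) * (xi n m l ^ 3)⁻¹ := by
    rw [← fderiv_apply, map_sum, Finset.sum_eq_single l]
    · simp only [fderiv_apply, fder_mul, fder_add, fder_one, fder_cc_zpow, fder_mult,
        fder_inv_sq, fder_xi]
      simp
      ring
    · intro i _ hi
      simp only [fderiv_apply, fder_mul, fder_add, fder_one, fder_cc_zpow, fder_mult,
        fder_inv_sq, fder_xi]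
      simp [hi.symm]
    · simp
  rw [potential, fder_add, hpair, hsingle, mul_add, Finset.mul_sum, sub_eq_add_neg]
  congr 1
  · refine Finset.sum_congr rfl fun j _ => ?_
    split_ifs with h
    · simp
    · rw [fder_pairPotential, hsub, fder_add, fder_xi, fder_xi, if_pos rfl, if_neg (Ne.symm h),
        show 1 - pE n m j = pE n m l + (1 - pE n m l - pE n m j) by ring,
        zpow_add₀ (cc_ne_zero hk)]
      ring
  · ring

variable (n m) in
/-- The data of the deformed rational Calogero-Moser-Sutherland system of type `B`. -/
def moserSystem {k q s : ℂ} (hk : k ≠ 0) (hrel : 2 * q + 1 = k * (2 * s + 1)) :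
    MoserSystem ℂ (Fin (n + m)) (F n m) where
  d := fderiv
  x := xi n m
  w i := cc n m k ^ pE n m i
  κ i := cc n m k ^ (1 - pE n m i)
  g i := cc n m k ^ pE n m i * mult n m q s i
  v i := cc n m k ^ (-pE n m i)
  U := potential n m k q s
  d_x := fder_xi
  d_comm := fder_comm
  d_w _ _ := fder_cc_zpow _ _ _
  d_κ _ _ := fder_cc_zpow _ _ _
  d_g _ _ := by simp [fder_mult, fder_cc_zpow]
  d_v _ _ := fder_cc_zpow _ _ _
  w_ne_zero _ := zpow_ne_zero _ (cc_ne_zero hk)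
  sub_ne_zero _ _ := xi_sub_ne_zero
  add_ne_zero := xi_add_ne_zero
  w_add_κ i j := by
    rcases pE_eq i with hi | hi <;> rcases pE_eq j with hj | hj <;> simp [hi, hj, add_comm]
  two_g_sub_κ i j := by
    have h := congrArg (cc n m) hrel
    simp only [cc_add, cc_mul, cc_one, cc_two] at h
    by_cases hi : (i : ℕ) < n <;> by_cases hj : (j : ℕ) < n <;> simp [pE, mult, hi, hj] <;>
      first | ring1 | linear_combination h | linear_combination -h
  v_mul_κ i j := by
    have := cc_ne_zero (n := n) (m := m) hk
    rw [← zpow_add₀ this, ← zpow_add₀ this]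
    congr 1
    ring
  d_U l := by
    rw [fderiv_apply, zpow_mul_fder_potential hk]
    rcases pE_eq l with hl | hl <;> simp [hl, add_comm]

variable {k q s : ℂ} (hk : k ≠ 0) (hrel : 2 * q + 1 = k * (2 * s + 1))

theorem L_moserSystem_apply (a b : Fin (n + m) ⊕ Fin (n + m)) (z : F n m) :
    (moserSystem n m hk hrel).L a b z = LB n m k q s a b z := by
  have hadd : ∀ i j : Fin (n + m), (-xi n m i - xi n m j)⁻¹ = -(xi n m i + xi n m j)⁻¹ :=
    fun i j => by rw [← inv_neg]; congr 1; ring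
  have hsub : ∀ i j : Fin (n + m), (-xi n m i + xi n m j)⁻¹ = -(xi n m i - xi n m j)⁻¹ :=
    fun i j => by rw [← inv_neg]; congr 1; ring
  have hinv : ∀ i : Fin (n + m), (2 : F n m) * (xi n m i + xi n m i)⁻¹ = (xi n m i)⁻¹ := fun i => by
    rw [← two_mul, mul_inv, mul_inv_cancel_left₀ two_ne_zero]
  rcases a with i | i <;> rcases b with j | j <;> by_cases hij : i = j
  all_goals
    simp [MoserSystem.L, MoserSystem.Λ, MoserSystem.c, MoserSystem.y, MoserSystem.D,
      MoserSystem.ix, moserSystem, LB, Amat, Bmat, @eq_comm _ j i, hij, hadd, hsub]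
  · ring
  · linear_combination cc n m k ^ pE n m j * mult n m q s j * z * hinv j
  · linear_combination -cc n m k ^ pE n m j * mult n m q s j * z * hinv j
  all_goals ring

theorem L_pow_moserSystem_apply (r : ℕ) (a b : Fin (n + m) ⊕ Fin (n + m)) (z : F n m) :
    ((moserSystem n m hk hrel).L ^ r) a b z = mpow (LB n m k q s) r a b z := by
  induction r generalizing a b z with
  | zero =>
    rw [pow_zero, Matrix.one_apply, mpow]
    split_ifs with h <;> simp [h]
  | succ r ih =>
    rw [pow_succ', Matrix.mul_apply, mpow, mmul, LinearMap.sum_apply]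
    refine Finset.sum_congr rfl fun e _ => ?_
    rw [Module.End.mul_apply, ih, L_moserSystem_apply]

theorem P_moserSystem_apply (l : ℕ) (z : F n m) :
    (moserSystem n m hk hrel).P (2 * l) z = LopB n m k q s l z := by
  have hv : ∀ a, (moserSystem n m hk hrel).v (MoserSystem.ix a) = estarB n m k a := by
    rintro (i | i) <;> rfl
  simp only [MoserSystem.P, LinearMap.sum_apply, Module.End.mul_apply, MoserSystem.mulHom_apply, hv,
    L_pow_moserSystem_apply, LopB]

theorem sum_eq_sum_filter_add {R : Type*} [AddCommMonoid R] (f : Fin (n + m) → R) :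
    ∑ i, f i = ∑ i ∈ Finset.univ.filter (fun i : Fin (n + m) => (i : ℕ) < n), f i
      + ∑ i ∈ Finset.univ.filter (fun i : Fin (n + m) => n ≤ (i : ℕ)), f i := by
  simp only [← not_lt, Finset.sum_filter_add_sum_filter_not]

theorem H_moserSystem_apply (z : F n m) :
    (moserSystem n m hk hrel).H z = HB n m k q s z := by
  have hpot : potential n m k q s =
      (∑ i : Fin (n + m), ∑ j : Fin (n + m),
        if (i : ℕ) < (j : ℕ) ∧ (j : ℕ) < n then
          2 * cc n m k * (cc n m k + 1) * (((xi n m i - xi n m j) ^ 2)⁻¹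
            + ((xi n m i + xi n m j) ^ 2)⁻¹) else 0)
      + (∑ i : Fin (n + m), ∑ j : Fin (n + m),
        if n ≤ (i : ℕ) ∧ (i : ℕ) < (j : ℕ) then
          2 * ((cc n m k)⁻¹ + 1) * (((xi n m i - xi n m j) ^ 2)⁻¹
            + ((xi n m i + xi n m j) ^ 2)⁻¹) else 0)
      + (∑ i : Fin (n + m), ∑ j : Fin (n + m),
        if (i : ℕ) < n ∧ n ≤ (j : ℕ) then
          2 * (cc n m k + 1) * (((xi n m i - xi n m j) ^ 2)⁻¹
            + ((xi n m i + xi n m j) ^ 2)⁻¹) else 0)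
      + ((∑ i ∈ Finset.univ.filter (fun i : Fin (n + m) => (i : ℕ) < n),
          cc n m q * (cc n m q + 1) * ((xi n m i) ^ 2)⁻¹)
        + (∑ j ∈ Finset.univ.filter (fun j : Fin (n + m) => n ≤ (j : ℕ)),
          cc n m k * cc n m s * (cc n m s + 1) * ((xi n m j) ^ 2)⁻¹)) := by
    rw [potential]
    congr 1
    · simp only [← Finset.sum_add_distrib]
      refine Finset.sum_congr rfl fun i _ => Finset.sum_congr rfl fun j _ => ?_
      have hk' := cc_ne_zero (n := n) (m := m) hk
      simp only [pairPotential, pE, Fin.lt_def]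
      rcases lt_or_ge (i : ℕ) n with hi | hi <;> rcases lt_or_ge (j : ℕ) n with hj | hj
      · simp [hi, hj, hi.not_ge, hj.not_ge]
      · simp [hi, hj, hi.not_ge, hj.not_gt, hi.trans_le hj]
      · simp [hi, hj, hi.not_gt, hj.not_ge, (hj.trans_le hi).not_gt]
      · simp [hi, hj, hi.not_gt, hj.not_gt]
        split_ifs
        · field_simp
          ring
        · rfl
    · rw [sum_eq_sum_filter_add]
      congr 1 <;> refine Finset.sum_congr rfl fun i hi => ?_
      · rw [Finset.mem_filter] at hi
        simp [pE, mult, hi.2]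
      · rw [Finset.mem_filter] at hi
        simp [pE, mult, hi.2.not_gt]
  have hkin : ∑ i, cc n m k ^ pE n m i * fder n m i (fder n m i z)
      = (∑ i ∈ Finset.univ.filter (fun i : Fin (n + m) => (i : ℕ) < n), fder n m i (fder n m i z))
        + cc n m k * ∑ j ∈ Finset.univ.filter (fun j : Fin (n + m) => n ≤ (j : ℕ)),
          fder n m j (fder n m j z) := by
    rw [sum_eq_sum_filter_add, Finset.mul_sum]
    congr 1 <;> refine Finset.sum_congr rfl fun i hi => ?_
    · rw [Finset.mem_filter] at hi
      simp [pE, hi.2]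
    · rw [Finset.mem_filter] at hi
      simp [pE, hi.2.not_gt]
  rw [MoserSystem.H_apply]
  change potential n m k q s * z - ∑ i, cc n m k ^ pE n m i * fder n m i (fder n m i z) = _
  rw [hkin, hpot, HB]
  ring

end RationalFunctions

end

/-- under the relation 2q + 1 = k(2s + 1), for every l ≥ 1 the operator
L^{(l)}_{n,m} = e*·L^{2l}·e commutes with the deformed rational B-type CMS operator
H_{n,m}, and moreover these operators commute with each other. -/
theorem Btype_deformed_integrals_commute (n m : ℕ) (k q s : ℂ) (hk : k ≠ 0)
    (hrel : 2 * q + 1 = k * (2 * s + 1)) :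
    (∀ l : ℕ, 1 ≤ l → ∀ z : F n m,
        LopB n m k q s l (HB n m k q s z) = HB n m k q s (LopB n m k q s l z)) ∧
    (∀ l l' : ℕ, 1 ≤ l → 1 ≤ l' → ∀ z : F n m,
        LopB n m k q s l (LopB n m k q s l' z) =
          LopB n m k q s l' (LopB n m k q s l z)) := by
  have hL := RationalFunctions.P_moserSystem_apply (n := n) (m := m) hk hrel
  have hH := RationalFunctions.H_moserSystem_apply (n := n) (m := m) hk hrel
  set S := RationalFunctions.moserSystem n m hk hrel
  refine ⟨fun l _ z => ?_, fun l l' _ _ z => ?_⟩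
  · simpa only [Module.End.mul_apply, hL, hH] using
      (LinearMap.congr_fun (S.commute_H_P (2 * l)).eq z).symm
  · simpa only [Module.End.mul_apply, hL] using
      LinearMap.congr_fun (S.commute_P_P (2 * l) (2 * l')).eq z
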